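/- For every partition λ, the following identity holds in ℚ(q1,q2,z): ((1 − q3/z)/(1 − 1/z)) · ∏_{c∈λ} g(z/χ_c) = ∏_{c∈A(λ)} (1 − q3 χ_c/z)/(1 − χ_c/z) · ∏_{c∈R(λ)} (1 − χ_c/(q3 z))/(1 − χ_c/z), where g(w) := (1−q1 w)(1−q2 w)(1−q3 w) / ((1−q1^{−1} w)(1−q2^{−1} w)(1−q3^{−1} w)). (This identifies the two product expressions for the function Ψ_λ(z) = Y_λ(q3^{−1}z)/Y_λ(z).) -/

import Mathlib

open scoped BigOperators

noncomputable section

/-- The field `ℚ(q1, q2, z)` of rational functions in three independent indeterminates. -/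
abbrev K : Type := FractionRing (MvPolynomial (Fin 3) ℚ)

/-- The indeterminate `q1`. -/
def q1 : K := algebraMap (MvPolynomial (Fin 3) ℚ) K (MvPolynomial.X 0)

/-- The indeterminate `q2`. -/
def q2 : K := algebraMap (MvPolynomial (Fin 3) ℚ) K (MvPolynomial.X 1)

/-- The indeterminate `z`. -/
def z : K := algebraMap (MvPolynomial (Fin 3) ℚ) K (MvPolynomial.X 2)

/-- `q3 = (q1 q2)⁻¹`. -/
def q3 : K := (q1 * q2)⁻¹

/-- Box content `χ_c = q1^(i-1) * q2^(j-1)` of the 1-indexed cell `(i,j)`.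
Here cells of a `YoungDiagram` are 0-indexed, so the cell `c` corresponding to the
1-indexed cell `(i,j)` is `c = (i-1, j-1)` and `χ_c = q1^c.1 * q2^c.2`. -/
def chi (c : ℕ × ℕ) : K := q1 ^ c.1 * q2 ^ c.2

/-- `c` is an addable cell of the Young diagram `d`: it is not a cell of `d` and adjoining
it again gives (the cells of) a Young diagram. -/
def IsAddable (d : YoungDiagram) (c : ℕ × ℕ) : Prop :=
  c ∉ d.cells ∧ IsLowerSet (↑(insert c d.cells) : Set (ℕ × ℕ))

/-- `c` is a removable cell of the Young diagram `d`: it is a cell of `d` and deleting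
it again gives (the cells of) a Young diagram. -/
def IsRemovable (d : YoungDiagram) (c : ℕ × ℕ) : Prop :=
  c ∈ d.cells ∧ IsLowerSet (↑(d.cells.erase c) : Set (ℕ × ℕ))

open Classical in
/-- The (finite) set `A(d)` of addable cells of `d`; every addable cell `(i,j)` satisfies
`i ≤ colLen 0` and `j ≤ rowLen 0`, so filtering the bounding box captures all of them. -/
noncomputable def addables (d : YoungDiagram) : Finset (ℕ × ℕ) :=
  (Finset.range (d.colLen 0 + 1) ×ˢ Finset.range (d.rowLen 0 + 1)).filter (IsAddable d)

open Classical in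
/-- The (finite) set `R(d)` of removable cells of `d`. -/
noncomputable def removables (d : YoungDiagram) : Finset (ℕ × ℕ) :=
  d.cells.filter (IsRemovable d)

/-- `g(w) = ∏_{α=1,2,3} (1 − q_α w)/(1 − q_α⁻¹ w)` with `q3 = (q1 q2)⁻¹`. -/
def gfun (w : K) : K :=
  ((1 - q1 * w) * (1 - q2 * w) * (1 - q3 * w)) /
    ((1 - q1⁻¹ * w) * (1 - q2⁻¹ * w) * (1 - q3⁻¹ * w))

lemma isAddable_iff (d : YoungDiagram) (a b : ℕ) : IsAddable d (a, b) ↔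
    (a, b) ∉ d.cells ∧ (∀ a', a = a' + 1 → (a', b) ∈ d.cells) ∧
      (∀ b', b = b' + 1 → (a, b') ∈ d.cells) := by
  unfold IsAddable
  refine and_congr_right fun hn => ⟨fun h => ⟨?_, ?_⟩, fun ⟨h1, h2⟩ => ?_⟩
  · rintro a' rfl
    have := h (show ((a', b) : ℕ × ℕ) ≤ (a' + 1, b) from ⟨by simp, by simp⟩) (by simp)
    simpa using this
  · rintro b' rfl
    have := h (show ((a, b') : ℕ × ℕ) ≤ (a, b' + 1) from ⟨by simp, by simp⟩) (by simp)
    simpa using this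
  · rintro ⟨x, y⟩ ⟨x', y'⟩ ⟨hx, hy⟩ hm
    simp only [Finset.coe_insert, Set.mem_insert_iff, Finset.mem_coe] at hm ⊢
    simp only at hx hy
    rcases hm with hm | hm
    · obtain ⟨rfl, rfl⟩ := Prod.mk.inj hm
      by_cases hxx : x' = x
      · by_cases hyy : y' = y
        · left; rw [hxx, hyy]
        · right
          obtain ⟨k, rfl⟩ : ∃ k, y = k + 1 := ⟨y - 1, by omega⟩
          exact d.isLowerSet (show ((x', y') : ℕ × ℕ) ≤ (x, k) from ⟨hx, by simp; omega⟩)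
            (h2 k rfl)
      · right
        obtain ⟨k, rfl⟩ : ∃ k, x = k + 1 := ⟨x - 1, by omega⟩
        exact d.isLowerSet (show ((x', y') : ℕ × ℕ) ≤ (k, y) from ⟨by simp; omega, hy⟩)
            (h1 k rfl)
    · right
      exact d.isLowerSet (show ((x', y') : ℕ × ℕ) ≤ (x, y) from ⟨hx, hy⟩) hm

lemma isRemovable_iff (d : YoungDiagram) (a b : ℕ) : IsRemovable d (a, b) ↔
    (a, b) ∈ d.cells ∧ (a + 1, b) ∉ d.cells ∧ (a, b + 1) ∉ d.cells := by
  unfold IsRemovable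
  refine and_congr_right fun hn => ⟨fun h => ⟨?_, ?_⟩, fun ⟨h1, h2⟩ => ?_⟩
  · intro hm
    have := h (show ((a, b) : ℕ × ℕ) ≤ (a + 1, b) from ⟨by simp, by simp⟩)
      (by simpa using hm)
    simp at this
  · intro hm
    have := h (show ((a, b) : ℕ × ℕ) ≤ (a, b + 1) from ⟨by simp, by simp⟩)
      (by simpa using hm)
    simp at this
  · rintro ⟨x, y⟩ ⟨x', y'⟩ ⟨hx, hy⟩ hm
    simp only [Finset.coe_erase, Set.mem_sdiff, Set.mem_singleton_iff, Finset.mem_coe] at hm ⊢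
    simp only at hx hy
    refine ⟨d.isLowerSet (show ((x', y') : ℕ × ℕ) ≤ (x, y) from ⟨hx, hy⟩) hm.1, ?_⟩
    intro he
    obtain ⟨rfl, rfl⟩ := Prod.mk.inj he
    by_cases hxx : x' = x
    · by_cases hyy : y' = y
      · exact hm.2 (by rw [hxx, hyy])
      · exact h2 (d.isLowerSet (show ((x', y' + 1) : ℕ × ℕ) ≤ (x, y) from
          ⟨hx, by simp; omega⟩) hm.1)
    · exact h1 (d.isLowerSet (show ((x' + 1, y') : ℕ × ℕ) ≤ (x, y) from
          ⟨by simp; omega, hy⟩) hm.1)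

lemma cell_bound (d : YoungDiagram) {a b : ℕ} (h : (a, b) ∈ d.cells) :
    a < d.colLen 0 ∧ b < d.rowLen 0 := by
  constructor
  · rw [← YoungDiagram.mem_iff_lt_colLen]
    exact d.isLowerSet (show ((a, 0) : ℕ × ℕ) ≤ (a, b) from ⟨le_rfl, by simp⟩) h
  · rw [← YoungDiagram.mem_iff_lt_rowLen]
    exact d.isLowerSet (show ((0, b) : ℕ × ℕ) ≤ (a, b) from ⟨by simp, le_rfl⟩) h

lemma mem_addables (d : YoungDiagram) (c : ℕ × ℕ) : c ∈ addables d ↔ IsAddable d c := by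
  obtain ⟨a, b⟩ := c
  unfold addables
  simp only [Finset.mem_filter, Finset.mem_product, Finset.mem_range, and_iff_right_iff_imp]
  rw [isAddable_iff]
  rintro ⟨-, h1, h2⟩
  constructor
  · rcases a with _ | a
    · omega
    · have := cell_bound d (h1 a rfl); omega
  · rcases b with _ | b
    · omega
    · have := cell_bound d (h2 b rfl); omega

lemma mem_removables (d : YoungDiagram) (c : ℕ × ℕ) : c ∈ removables d ↔ IsRemovable d c := by
  unfold removables
  simp only [Finset.mem_filter, and_iff_right_iff_imp]
  exact fun h => h.1

open Classical in
lemma prod_shift {F : Type*} [CommMonoid F] (T S : Finset (ℕ × ℕ)) (e : ℕ × ℕ → ℕ × ℕ)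
    (he : Function.Injective e) (hS : ∀ c ∈ T, e c ∈ S) (h : ℕ × ℕ → F) :
    ∏ c ∈ T, h (e c) = ∏ x ∈ S, if x ∈ T.image e then h x else 1 := by
  rw [Finset.prod_ite_mem, Finset.inter_eq_right.2, Finset.prod_image]
  · exact fun _ _ _ _ h => he h
  · intro x hx
    obtain ⟨c, hc, rfl⟩ := Finset.mem_image.1 hx
    exact hS c hc

lemma comb {F : Type*} [CommMonoid F] (d : YoungDiagram) (h : ℕ × ℕ → F) :
    h (0, 0) * (∏ c ∈ d.cells, h (c.1 + 1, c.2)) * (∏ c ∈ d.cells, h (c.1, c.2 + 1)) *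
      (∏ c ∈ removables d, h (c.1 + 1, c.2 + 1)) =
    (∏ c ∈ addables d, h c) * (∏ c ∈ d.cells, h c) *
      (∏ c ∈ d.cells, h (c.1 + 1, c.2 + 1)) := by
  classical
  set S := Finset.range (d.colLen 0 + 2) ×ˢ Finset.range (d.rowLen 0 + 2) with hS
  have hb : ∀ c ∈ d.cells, c.1 < d.colLen 0 ∧ c.2 < d.rowLen 0 := fun c hc => cell_bound d hc
  have hr : ∀ c ∈ removables d, c.1 < d.colLen 0 ∧ c.2 < d.rowLen 0 :=
    fun c hc => hb c ((mem_removables d c).1 hc).1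
  have ha : ∀ c ∈ addables d, c ∈ S := by
    intro c hc
    unfold addables at hc
    simp only [Finset.mem_filter, Finset.mem_product, Finset.mem_range] at hc
    simp only [hS, Finset.mem_product, Finset.mem_range]
    omega
  have e0 : h (0, 0) = ∏ x ∈ S, if x = (0, 0) then h x else 1 := by
    rw [Finset.prod_ite_eq' S (0, 0) h, if_pos]
    simp [hS]
  have e1 := prod_shift d.cells S (fun c => (c.1 + 1, c.2))
    (by rintro ⟨a, b⟩ ⟨a', b'⟩ hh; simpa using hh)
    (by intro c hc; have := hb c hc; simp only [hS, Finset.mem_product, Finset.mem_range]; omega) h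
  have e2 := prod_shift d.cells S (fun c => (c.1, c.2 + 1))
    (by rintro ⟨a, b⟩ ⟨a', b'⟩ hh; simpa using hh)
    (by intro c hc; have := hb c hc; simp only [hS, Finset.mem_product, Finset.mem_range]; omega) h
  have e3 := prod_shift d.cells S (fun c => (c.1 + 1, c.2 + 1))
    (by rintro ⟨a, b⟩ ⟨a', b'⟩ hh; simpa using hh)
    (by intro c hc; have := hb c hc; simp only [hS, Finset.mem_product, Finset.mem_range]; omega) h
  have e4 := prod_shift (removables d) S (fun c => (c.1 + 1, c.2 + 1))
    (by rintro ⟨a, b⟩ ⟨a', b'⟩ hh; simpa using hh)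
    (by intro c hc; have := hr c hc; simp only [hS, Finset.mem_product, Finset.mem_range]; omega) h
  have e5 := prod_shift d.cells S (fun c => c) (fun _ _ hh => hh)
    (by intro c hc; have := hb c hc; simp only [hS, Finset.mem_product, Finset.mem_range]; omega) h
  have e6 := prod_shift (addables d) S (fun c => c) (fun _ _ hh => hh) ha h
  rw [e0, e1, e2, e3, e4, e5, e6]
  simp only [← Finset.prod_mul_distrib]
  refine Finset.prod_congr rfl ?_
  rintro ⟨a, b⟩ -
  clear e0 e1 e2 e3 e4 e5 e6 ha hr hb
  have lo1 : ∀ a b, (a + 1, b) ∈ d.cells → (a, b) ∈ d.cells := fun a b hm =>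
    d.isLowerSet (show ((a, b) : ℕ × ℕ) ≤ (a + 1, b) from ⟨by simp, by simp⟩) hm
  have lo2 : ∀ a b, (a, b + 1) ∈ d.cells → (a, b) ∈ d.cells := fun a b hm =>
    d.isLowerSet (show ((a, b) : ℕ × ℕ) ≤ (a, b + 1) from ⟨by simp, by simp⟩) hm
  rcases a with _ | a <;> rcases b with _ | b <;>
    simp only [Finset.mem_image, Prod.exists, Prod.mk.injEq, mem_addables, mem_removables,
      isAddable_iff, isRemovable_iff, Nat.add_right_cancel_iff, exists_eq_right_right,
      exists_eq_right, Nat.add_eq_zero_iff, one_ne_zero, and_false, false_and, exists_false,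
      if_false, and_true, true_and, forall_eq', Nat.add_one_ne_zero,
      reduceCtorEq, false_imp_iff, imp_true_iff, implies_true, if_true, one_mul, mul_one]
  · by_cases p : (0, 0) ∈ d.cells <;> simp [p]
  · have := lo2 0 b
    by_cases p : (0, b) ∈ d.cells <;> by_cases q : (0, b + 1) ∈ d.cells <;> simp_all
  · have := lo1 a 0
    by_cases p : (a, 0) ∈ d.cells <;> by_cases q : (a + 1, 0) ∈ d.cells <;> simp_all
  · have h1 := lo1 a b
    have h2 := lo2 a b
    have h3 := lo1 a (b + 1)
    have h4 := lo2 (a + 1) b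
    clear lo1 lo2
    generalize h (a + 1, b + 1) = t
    by_cases p : (a, b) ∈ d.cells <;> by_cases q : (a + 1, b) ∈ d.cells <;>
    by_cases r : (a, b + 1) ∈ d.cells <;> by_cases s : (a + 1, b + 1) ∈ d.cells <;> simp_all

lemma mon_ne (a b c e : ℕ) : q1 ^ a * q2 ^ b * z ≠ q1 ^ c * q2 ^ e := by
  unfold q1 q2 z
  simp only [← map_pow, ← map_mul]
  intro hh
  have := IsFractionRing.injective (MvPolynomial (Fin 3) ℚ) K hh
  have := congrArg (MvPolynomial.eval (fun i : Fin 3 => if i = 2 then (2 : ℚ) else 1)) this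
  simp at this

lemma q1_ne : q1 ≠ 0 := by
  intro h
  have := mon_ne 1 0 1 0
  simp [h] at this

lemma q2_ne : q2 ≠ 0 := by
  intro h
  have := mon_ne 0 1 0 1
  simp [h] at this

lemma z_ne : z ≠ 0 := by
  unfold z
  intro h
  have := (IsFractionRing.injective (MvPolynomial (Fin 3) ℚ) K) (h.trans (map_zero _).symm)
  exact MvPolynomial.X_ne_zero _ this

/-- the local factor -/
def hfun (c : ℕ × ℕ) : K := (1 - q3 * chi c / z) / (1 - chi c / z)

lemma den_ne (c : ℕ × ℕ) : 1 - chi c / z ≠ 0 := by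
  intro h
  have h2 := z_ne
  have := mon_ne 0 0 c.1 c.2
  apply this
  rw [sub_eq_zero, eq_comm, div_eq_one_iff_eq h2] at h
  simpa [chi] using h.symm

lemma num_ne (c : ℕ × ℕ) : 1 - q3 * chi c / z ≠ 0 := by
  intro h
  have h2 := z_ne
  have := mon_ne 1 1 c.1 c.2
  apply this
  rw [sub_eq_zero, eq_comm, div_eq_one_iff_eq h2] at h
  have h3 := q1_ne
  have h4 := q2_ne
  rw [← h, q3, chi]
  field_simp

lemma hfun_ne (c : ℕ × ℕ) : hfun c ≠ 0 := div_ne_zero (num_ne c) (den_ne c)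

lemma alg {F : Type*} [Field F] (p q y x : F) (hp : p ≠ 0) (hq : q ≠ 0) (hy : y ≠ 0)
    (hx : x ≠ 0) (h1 : y - x ≠ 0) (h2 : y - p * x ≠ 0) (h3 : y - q * x ≠ 0)
    (h4 : y - p * q * x ≠ 0) (h5 : p * q * y - x ≠ 0) :
    ((1 - p * (y / x)) * (1 - q * (y / x)) * (1 - (p * q)⁻¹ * (y / x))) /
    ((1 - p⁻¹ * (y / x)) * (1 - q⁻¹ * (y / x)) * (1 - (p * q)⁻¹⁻¹ * (y / x))) *
      (((1 - (p * q)⁻¹ * x / y) / (1 - x / y)) *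
        ((1 - (p * q)⁻¹ * (p * q * x) / y) / (1 - p * q * x / y))) =
      ((1 - (p * q)⁻¹ * (p * x) / y) / (1 - p * x / y)) *
      ((1 - (p * q)⁻¹ * (q * x) / y) / (1 - q * x / y)) := by
  have a1 : 1 - x / y = (y - x) / y := by field_simp
  have a2 : 1 - p * x / y = (y - p * x) / y := by field_simp
  have a3 : 1 - q * x / y = (y - q * x) / y := by field_simp
  have a4 : 1 - p * q * x / y = (y - p * q * x) / y := by field_simp
  have a5 : 1 - (p * q)⁻¹ * x / y = (p * q * y - x) / (p * q * y) := by field_simp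
  have a6 : 1 - (p * q)⁻¹ * (p * q * x) / y = (y - x) / y := by field_simp
  have a7 : 1 - (p * q)⁻¹ * (p * x) / y = (q * y - x) / (q * y) := by field_simp
  have a8 : 1 - (p * q)⁻¹ * (q * x) / y = (p * y - x) / (p * y) := by field_simp
  have b1 : 1 - p * (y / x) = -(p * y - x) / x := by field_simp; ring
  have b2 : 1 - q * (y / x) = -(q * y - x) / x := by field_simp; ring
  have b3 : 1 - (p * q)⁻¹ * (y / x) = -(y - p * q * x) / (p * q * x) := by field_simp; ring
  have b4 : 1 - p⁻¹ * (y / x) = -(y - p * x) / (p * x) := by field_simp; ring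
  have b5 : 1 - q⁻¹ * (y / x) = -(y - q * x) / (q * x) := by field_simp; ring
  have b6 : 1 - (p * q)⁻¹⁻¹ * (y / x) = -(p * q * y - x) / x := by
    rw [inv_inv]; field_simp; ring
  rw [a1, a2, a3, a4, a5, a6, a7, a8, b1, b2, b3, b4, b5, b6]
  generalize p * q * y - x = A at *
  generalize y - p * q * x = B at *
  generalize y - p * x = C at *
  generalize y - q * x = D at *
  generalize y - x = E at *
  generalize p * y - x = G at *
  generalize q * y - x = H at *
  field_simp

lemma sub_of_den {c : ℕ × ℕ} {x : K} (hc : chi c = x) : z - x ≠ 0 := by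
  intro h
  apply den_ne c
  have := z_ne
  rw [hc, ← sub_eq_zero.1 h, div_self this, sub_self]

lemma cell_id (c : ℕ × ℕ) : gfun (z / chi c) * (hfun c * hfun (c.1 + 1, c.2 + 1)) =
    hfun (c.1 + 1, c.2) * hfun (c.1, c.2 + 1) := by
  have h1 := q1_ne
  have h2 := q2_ne
  have c1 : chi (c.1 + 1, c.2) = q1 * chi c := by simp only [chi]; ring
  have c2 : chi (c.1, c.2 + 1) = q2 * chi c := by simp only [chi]; ring
  have c3 : chi (c.1 + 1, c.2 + 1) = q1 * q2 * chi c := by simp only [chi]; ring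
  have h5 : q1 * q2 * z - chi c ≠ 0 := by
    intro h
    apply mon_ne 1 1 c.1 c.2
    simpa [chi] using sub_eq_zero.1 h
  have := alg q1 q2 z (chi c) h1 h2 z_ne (by simp [chi, h1, h2]) (sub_of_den rfl)
    (sub_of_den c1) (sub_of_den c2) (sub_of_den c3) h5
  simp only [gfun, hfun, c1, c2, c3, q3]
  exact this

lemma rem_id (c : ℕ × ℕ) : (1 - chi c / (q3 * z)) / (1 - chi c / z) =
    (hfun (c.1 + 1, c.2 + 1))⁻¹ := by
  have h1 := q1_ne
  have h2 := q2_ne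
  have c3 : chi (c.1 + 1, c.2 + 1) = q1 * q2 * chi c := by simp only [chi]; ring
  rw [hfun, inv_div, c3]
  congr 2
  · rw [q3, ← div_div, div_inv_eq_mul]; ring
  · rw [q3]; field_simp

/-- For every partition `λ`, in `ℚ(q1,q2,z)`:
`((1 − q3/z)/(1 − 1/z)) ∏_{c∈λ} g(z/χ_c)`
`  = ∏_{c∈A(λ)} (1 − q3 χ_c/z)/(1 − χ_c/z) · ∏_{c∈R(λ)} (1 − χ_c/(q3 z))/(1 − χ_c/z)`. -/
theorem stmt2 (d : YoungDiagram) :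
    ((1 - q3 / z) / (1 - 1 / z)) * ∏ c ∈ d.cells, gfun (z / chi c)
      = (∏ c ∈ addables d, ((1 - q3 * chi c / z) / (1 - chi c / z))) *
          ∏ c ∈ removables d, ((1 - chi c / (q3 * z)) / (1 - chi c / z)) := by
  have hA : ((1 - q3 / z) / (1 - 1 / z)) = hfun (0, 0) := by simp [hfun, chi]
  have hB : (∏ c ∈ addables d, ((1 - q3 * chi c / z) / (1 - chi c / z))) =
    ∏ c ∈ addables d, hfun c := rfl
  rw [hA, hB, Finset.prod_congr rfl (fun c _ => rem_id c), Finset.prod_inv_distrib]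
  have hC := Finset.prod_congr (rfl : d.cells = d.cells) (fun c _ => cell_id c)
  simp only [Finset.prod_mul_distrib] at hC
  have hD := comb d hfun
  have n1 : ∏ c ∈ removables d, hfun (c.1 + 1, c.2 + 1) ≠ 0 :=
    Finset.prod_ne_zero_iff.2 fun c _ => hfun_ne _
  have n2 : ∏ c ∈ d.cells, hfun c ≠ 0 := Finset.prod_ne_zero_iff.2 fun c _ => hfun_ne _
  have n3 : ∏ c ∈ d.cells, hfun (c.1 + 1, c.2 + 1) ≠ 0 :=
    Finset.prod_ne_zero_iff.2 fun c _ => hfun_ne _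
  rw [eq_mul_inv_iff_mul_eq₀ n1]
  apply mul_right_cancel₀ (mul_ne_zero n2 n3)
  rw [← mul_assoc (∏ c ∈ addables d, hfun c), ← hD,
    mul_assoc (hfun (0, 0)) (∏ c ∈ d.cells, hfun (c.1 + 1, c.2)), ← hC]
  ring

end
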